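/- arXiv:2305.08270 — 5 statements merged into one kernel-verified Lean document; each statement's English description precedes it below -/
import Mathlib

section
/- Let P, S ∈ K^{n×m} and M = ran [P; S] = {(Px, Sx) : x ∈ K^m} ⊆ K^n × K^n. Then M is a Lagrange structure (M = M*) if and only if S*P = P*S and rank [P; S] = n. -/
open scoped BigOperators
open Matrix

noncomputable section

variable {𝕜 : Type*} [RCLike 𝕜]

/-- The pairing ⟨x,y⟩ = y*x = ∑ conj(y i) * x i. -/
def herm {ι : Type*} [Fintype ι] (x y : ι → 𝕜) : 𝕜 :=
  ∑ i, (starRingEnd 𝕜) (y i) * x i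

/-- The adjoint relation A* = {(e',f') : ⟨f',e⟩ = ⟨e',f⟩ for all (e,f) ∈ A}. -/
def adjRel {ι : Type*} [Fintype ι] (A : Submodule 𝕜 ((ι → 𝕜) × (ι → 𝕜))) :
    Submodule 𝕜 ((ι → 𝕜) × (ι → 𝕜)) where
  carrier := {p | ∀ q ∈ A, herm p.2 q.1 = herm p.1 q.2}
  add_mem' := by
    intro a b ha hb q hq
    have h1 := ha q hq
    have h2 := hb q hq
    simp only [herm, Prod.snd_add, Prod.fst_add, Pi.add_apply, mul_add,
      Finset.sum_add_distrib] at *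
    rw [h1, h2]
  zero_mem' := by
    intro q hq
    simp [herm]
  smul_mem' := by
    intro c p hp q hq
    have h := hp q hq
    simp only [herm, Prod.smul_snd, Prod.smul_fst, Pi.smul_apply, smul_eq_mul] at *
    calc ∑ i, (starRingEnd 𝕜) (q.1 i) * (c * p.2 i)
        = c * ∑ i, (starRingEnd 𝕜) (q.1 i) * p.2 i := by
          rw [Finset.mul_sum]; congr 1; ext i; ring
      _ = c * ∑ i, (starRingEnd 𝕜) (q.2 i) * p.1 i := by rw [h]
      _ = ∑ i, (starRingEnd 𝕜) (q.2 i) * (c * p.1 i) := by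
          rw [Finset.mul_sum]; congr 1; ext i; ring

/-- The relation −A* = {(e',−f') : (e',f') ∈ A*}. -/
def negAdj {ι : Type*} [Fintype ι] (A : Submodule 𝕜 ((ι → 𝕜) × (ι → 𝕜))) :
    Submodule 𝕜 ((ι → 𝕜) × (ι → 𝕜)) :=
  (adjRel A).map ((LinearMap.fst 𝕜 (ι → 𝕜) (ι → 𝕜)).prod (-(LinearMap.snd 𝕜 (ι → 𝕜) (ι → 𝕜))))

/-- Kernel representation ker [K, L] = {(f,e) : Kf + Le = 0}. -/
def kerRep {p n : ℕ} (K L : Matrix (Fin p) (Fin n) 𝕜) :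
    Submodule 𝕜 ((Fin n → 𝕜) × (Fin n → 𝕜)) :=
  LinearMap.ker (K.mulVecLin.comp (LinearMap.fst 𝕜 (Fin n → 𝕜) (Fin n → 𝕜)) +
    L.mulVecLin.comp (LinearMap.snd 𝕜 (Fin n → 𝕜) (Fin n → 𝕜)))

/-- Image representation ran [F; G] = {(Fx, Gx) : x}. -/
def ranRep {n m : ℕ} (F G : Matrix (Fin n) (Fin m) 𝕜) :
    Submodule 𝕜 ((Fin n → 𝕜) × (Fin n → 𝕜)) :=
  LinearMap.range (F.mulVecLin.prod G.mulVecLin)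

/-- The kernel of a linear relation: ker A = {f : (f,0) ∈ A}. -/
def kerRel {ι : Type*} [Fintype ι] (A : Submodule 𝕜 ((ι → 𝕜) × (ι → 𝕜))) :
    Submodule 𝕜 (ι → 𝕜) :=
  A.comap (LinearMap.prod LinearMap.id 0)

end

theorem herm_eq_dotProduct {𝕜 ι : Type*} [RCLike 𝕜] [Fintype ι] (x y : ι → 𝕜) :
    herm x y = star y ⬝ᵥ x := rfl

theorem herm_mulVec_right {𝕜 ι κ : Type*} [RCLike 𝕜] [Fintype ι] [Fintype κ]
    (A : Matrix ι κ 𝕜) (y : ι → 𝕜) (x : κ → 𝕜) :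
    herm y (A *ᵥ x) = star x ⬝ᵥ (Aᴴ *ᵥ y) := by
  rw [herm_eq_dotProduct, star_mulVec, dotProduct_mulVec]

/-- The adjoint of an image representation is the kernel of `[-Sᴴ, Pᴴ]`. -/
theorem mem_adjRel_ranRep {𝕜 : Type*} [RCLike 𝕜] {n m : ℕ} (P S : Matrix (Fin n) (Fin m) 𝕜)
    (p : (Fin n → 𝕜) × (Fin n → 𝕜)) :
    p ∈ adjRel (ranRep P S) ↔ Pᴴ *ᵥ p.2 = Sᴴ *ᵥ p.1 := by
  have h : p ∈ adjRel (ranRep P S) ↔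
      ∀ x : Fin m → 𝕜, star x ⬝ᵥ (Pᴴ *ᵥ p.2) = star x ⬝ᵥ (Sᴴ *ᵥ p.1) := by
    simp only [← herm_mulVec_right]
    exact Set.forall_mem_range
  rw [h]
  refine ⟨fun h => dotProduct_eq _ _ fun u => ?_, fun h x => by rw [h]⟩
  simpa [dotProduct_comm] using h (star u)

theorem ranRep_le_adjRel_iff {𝕜 : Type*} [RCLike 𝕜] {n m : ℕ} (P S : Matrix (Fin n) (Fin m) 𝕜) :
    ranRep P S ≤ adjRel (ranRep P S) ↔ Sᴴ * P = Pᴴ * S := by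
  have h : ranRep P S ≤ adjRel (ranRep P S) ↔
      ∀ x : Fin m → 𝕜, Pᴴ *ᵥ (S *ᵥ x) = Sᴴ *ᵥ (P *ᵥ x) := by
    simp only [SetLike.le_def, mem_adjRel_ranRep]
    exact Set.forall_mem_range
  simp only [h, mulVec_mulVec, ← ext_iff_mulVec, eq_comm]

theorem finrank_ranRep {𝕜 : Type*} [RCLike 𝕜] {n m : ℕ} (P S : Matrix (Fin n) (Fin m) 𝕜) :
    Module.finrank 𝕜 (ranRep P S) = (fromRows P S).rank := by
  let J := LinearEquiv.sumArrowLequivProdArrow (Fin n) (Fin n) 𝕜 𝕜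
  have h : ranRep P S = (LinearMap.range (fromRows P S).mulVecLin).map J.toLinearMap := by
    rw [← LinearMap.range_comp]
    rfl
  rw [h, LinearEquiv.finrank_map_eq]
  rfl

theorem rank_fromRows_neg_swap {𝕜 : Type*} [RCLike 𝕜] {n m : ℕ}
    (P S : Matrix (Fin n) (Fin m) 𝕜) :
    (fromRows (-S) P).rank = (fromRows P S).rank := by
  have h : ranRep (-S) P = (ranRep P S).map
      (LinearEquiv.skewSwap 𝕜 (Fin n → 𝕜) (Fin n → 𝕜)).toLinearMap := by
    rw [ranRep, ranRep, ← LinearMap.range_comp]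
    congr 1
    ext <;> simp
  rw [← finrank_ranRep, ← finrank_ranRep, h, LinearEquiv.finrank_map_eq]

open scoped ComplexOrder in
theorem finrank_ranRep_add_finrank_adjRel {𝕜 : Type*} [RCLike 𝕜] {n m : ℕ}
    (P S : Matrix (Fin n) (Fin m) 𝕜) :
    Module.finrank 𝕜 (ranRep P S) + Module.finrank 𝕜 (adjRel (ranRep P S)) = 2 * n := by
  let J := LinearEquiv.sumArrowLequivProdArrow (Fin n) (Fin n) 𝕜 𝕜
  have hker : LinearMap.ker (fromRows (-S) P)ᴴ.mulVecLin =
      (adjRel (ranRep P S)).comap J.toLinearMap := by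
    ext v
    rw [LinearMap.mem_ker, Submodule.mem_comap, mem_adjRel_ranRep, mulVecLin_apply,
      conjTranspose_fromRows_eq_fromCols_conjTranspose, fromCols_mulVec, conjTranspose_neg,
      neg_mulVec, neg_add_eq_zero, eq_comm]
    rfl
  have hrank : Module.finrank 𝕜 (LinearMap.range (fromRows (-S) P)ᴴ.mulVecLin) =
      Module.finrank 𝕜 (ranRep P S) := by
    rw [finrank_ranRep, ← rank_fromRows_neg_swap, ← rank_conjTranspose]
    rfl
  have h := LinearMap.finrank_range_add_finrank_ker (fromRows (-S) P)ᴴ.mulVecLin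
  rw [hrank, hker, Submodule.comap_equiv_eq_map_symm, LinearEquiv.finrank_map_eq] at h
  simpa [two_mul] using h

/-- ran [P; S] is a Lagrange structure iff S*P = P*S and rank [P;S] = n. -/
theorem ranRep_lagrange_iff {𝕜 : Type*} [RCLike 𝕜] {n m : ℕ}
    (P S : Matrix (Fin n) (Fin m) 𝕜) :
    ranRep P S = adjRel (ranRep P S) ↔
      (Sᴴ * P = Pᴴ * S ∧ Module.finrank 𝕜 (ranRep P S) = n) := by
  have hdim := finrank_ranRep_add_finrank_adjRel P S
  rw [← ranRep_le_adjRel_iff]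
  constructor
  · intro h
    rw [← h] at hdim
    exact ⟨h.le, by omega⟩
  · rintro ⟨hle, hn⟩
    exact Submodule.eq_of_le_of_finrank_eq hle (by omega)
end

section
/- A maximal monotone subspace M ⊆ K^n × K^n is maximal monotone if and only if its adjoint M* is maximal monotone. -/
open scoped BigOperators
open Matrix

lemma star_herm {𝕜 : Type*} [RCLike 𝕜] {ι : Type*} [Fintype ι] (x y : ι → 𝕜) :
    (starRingEnd 𝕜) (herm x y) = herm y x := by
  simp [herm, map_sum, mul_comm]

lemma le_adjRel_adjRel {𝕜 : Type*} [RCLike 𝕜] {ι : Type*} [Fintype ι]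
    (A : Submodule 𝕜 ((ι → 𝕜) × (ι → 𝕜))) : A ≤ adjRel (adjRel A) := by
  intro p hp q hq
  have h : herm q.2 p.1 = herm q.1 p.2 := hq p hp
  rw [← star_herm q.1 p.2, ← star_herm q.2 p.1, h]

lemma finrank_add_finrank_adjRel {𝕜 : Type*} [RCLike 𝕜] {ι : Type*} [Fintype ι]
    (A : Submodule 𝕜 ((ι → 𝕜) × (ι → 𝕜))) :
    Module.finrank 𝕜 A + Module.finrank 𝕜 (adjRel A) = 2 * Fintype.card ι := by
  let e : ((ι → 𝕜) × (ι → 𝕜)) ≃ₗ[𝕜] EuclideanSpace 𝕜 (ι ⊕ ι) :=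
    (LinearEquiv.sumArrowLequivProdArrow ι ι 𝕜 𝕜).symm ≪≫ₗ
      (WithLp.linearEquiv 2 𝕜 (ι ⊕ ι → 𝕜)).symm
  let r : ((ι → 𝕜) × (ι → 𝕜)) ≃ₗ[𝕜] ((ι → 𝕜) × (ι → 𝕜)) :=
    LinearEquiv.prodComm 𝕜 (ι → 𝕜) (ι → 𝕜) ≪≫ₗ
      (LinearEquiv.refl 𝕜 (ι → 𝕜)).prodCongr (LinearEquiv.neg 𝕜)
  have hmap : (adjRel A).map (r ≪≫ₗ e).toLinearMap = (A.map e.toLinearMap)ᗮ := by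
    ext v
    obtain ⟨p, rfl⟩ := (r ≪≫ₗ e).surjective v
    have hinner (q : (ι → 𝕜) × (ι → 𝕜)) :
        inner 𝕜 (e q) ((r ≪≫ₗ e) p) = herm p.2 q.1 - herm p.1 q.2 := by
      simp [e, r, herm, PiLp.inner_apply, LinearEquiv.sumArrowLequivProdArrow,
        Equiv.sumArrowEquivProdArrow, mul_comm, sub_eq_add_neg]
    have hv : (r ≪≫ₗ e) p ∈ (adjRel A).map (r ≪≫ₗ e).toLinearMap ↔ p ∈ adjRel A :=
      Function.Injective.mem_set_image (r ≪≫ₗ e).injective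
    rw [hv, Submodule.mem_orthogonal]
    constructor
    · rintro hp _ ⟨q, hq, rfl⟩
      exact (hinner q).trans (sub_eq_zero.2 (hp q hq))
    · intro h q hq
      exact sub_eq_zero.1 ((hinner q).symm.trans (h _ ⟨q, hq, rfl⟩))
  have h := (A.map e.toLinearMap).finrank_add_finrank_orthogonal
  rw [← hmap, LinearEquiv.finrank_map_eq, LinearEquiv.finrank_map_eq,
    finrank_euclideanSpace, Fintype.card_sum] at h
  omega

lemma adjRel_monotone {𝕜 : Type*} [RCLike 𝕜] {ι : Type*} [Fintype ι]
    (M : Submodule 𝕜 ((ι → 𝕜) × (ι → 𝕜)))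
    (hM : ∀ p ∈ M, 0 ≤ RCLike.re (herm p.2 p.1))
    (hdim : Module.finrank 𝕜 M = Fintype.card ι) :
    ∀ p ∈ adjRel M, 0 ≤ RCLike.re (herm p.2 p.1) := by
  intro p hp
  by_contra! hneg
  let T : (M × 𝕜) →ₗ[𝕜] (ι → 𝕜) :=
    ((LinearMap.fst 𝕜 (ι → 𝕜) (ι → 𝕜) + LinearMap.snd 𝕜 (ι → 𝕜) (ι → 𝕜)).comp
      M.subtype).coprod (LinearMap.toSpanSingleton 𝕜 (ι → 𝕜) (p.1 - p.2))
  have hker : LinearMap.ker T ≠ ⊥ := by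
    apply LinearMap.ker_ne_bot_of_finrank_lt
    simp [hdim]
  obtain ⟨⟨⟨m, hm⟩, c⟩, hT, hne⟩ := (Submodule.ne_bot_iff _).1 hker
  have hT' : m.1 + m.2 + c • (p.1 - p.2) = 0 := by simpa [T] using hT
  have hm2 : m.2 = c • p.2 - (m.1 + c • p.1) := by
    rw [← sub_eq_zero, ← hT', smul_sub]; abel
  set x := m.1 + c • p.1 with hx
  have hexp : herm (m.2 - c • p.2) x = herm m.2 m.1 + (starRingEnd 𝕜) c * herm m.2 p.1
      - c * herm p.2 m.1 - c * (starRingEnd 𝕜) c * herm p.2 p.1 := by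
    simp only [herm, hx, Finset.mul_sum, ← Finset.sum_add_distrib, ← Finset.sum_sub_distrib]
    refine Finset.sum_congr rfl fun i _ => ?_
    simp only [Pi.add_apply, Pi.sub_apply, Pi.smul_apply, smul_eq_mul, map_add, map_mul]
    ring
  have hcross : c * herm p.2 m.1 = (starRingEnd 𝕜) ((starRingEnd 𝕜) c * herm m.2 p.1) := by
    rw [map_mul, RCLike.conj_conj, star_herm, hp m hm]
  have hxx : herm (m.2 - c • p.2) x = -((∑ i, ‖x i‖ ^ 2 : ℝ) : 𝕜) := by
    rw [hm2]
    simp [herm, RCLike.conj_mul]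
  have hre : -(∑ i, ‖x i‖ ^ 2) =
      RCLike.re (herm m.2 m.1) - ‖c‖ ^ 2 * RCLike.re (herm p.2 p.1) := by
    have h := congrArg RCLike.re (hxx.symm.trans hexp)
    rw [hcross, RCLike.mul_conj, ← RCLike.ofReal_pow] at h
    simp only [map_neg, map_sub, map_add, RCLike.conj_re, RCLike.re_ofReal_mul,
      RCLike.ofReal_re] at h
    linarith
  have hsum : 0 ≤ ∑ i, ‖x i‖ ^ 2 := by positivity
  have hmm := hM m hm
  have hc : c = 0 := by
    by_contra hc
    have : 0 < ‖c‖ ^ 2 := by positivity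
    nlinarith
  have hx0 : x = 0 := by
    have h0 : ∑ i, ‖x i‖ ^ 2 = 0 := by
      rw [hc, norm_zero] at hre
      nlinarith
    rw [Finset.sum_eq_zero_iff_of_nonneg (fun i _ => by positivity)] at h0
    ext i
    simpa using h0 i (Finset.mem_univ i)
  have hm1 : m.1 = 0 := by simpa [hc] using hx.symm.trans hx0
  have hm2' : m.2 = 0 := by rw [hm2, hx0, hc]; simp
  exact hne (Prod.ext (Subtype.ext (Prod.ext hm1 hm2')) hc)

/-- M is maximal monotone iff M* is maximal monotone. -/
theorem maxMonotone_iff_adj_maxMonotone {𝕜 : Type*} [RCLike 𝕜] {n : ℕ}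
    (M : Submodule 𝕜 ((Fin n → 𝕜) × (Fin n → 𝕜))) :
    ((∀ p ∈ M, 0 ≤ RCLike.re (herm p.2 p.1)) ∧ Module.finrank 𝕜 M = n) ↔
    ((∀ p ∈ adjRel M, 0 ≤ RCLike.re (herm p.2 p.1)) ∧
      Module.finrank 𝕜 (adjRel M) = n) := by
  have hdim := finrank_add_finrank_adjRel M
  have hdim' := finrank_add_finrank_adjRel (adjRel M)
  rw [Fintype.card_fin] at hdim hdim'
  constructor
  · rintro ⟨hM, hn⟩
    exact ⟨adjRel_monotone M hM (by simpa using hn), by omega⟩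
  · rintro ⟨hM, hn⟩
    exact ⟨fun p hp => adjRel_monotone (adjRel M) hM (by simpa using hn) p
      (le_adjRel_adjRel M hp), by omega⟩
end

section
/- Every monotone subspace M of ℂ^n × ℂ^n extends to a maximal monotone subspace: if Re⟨e,f⟩ ≥ 0 for all (f,e) ∈ M, then there exists a subspace M' ⊇ M with dim M' = n and Re⟨e,f⟩ ≥ 0 for all (f,e) ∈ M'. -/
open scoped BigOperators
open Matrix

theorem herm_eq_inner {ι : Type*} [Fintype ι] (x y : ι → ℂ) :
    herm x y = inner ℂ (WithLp.toLp 2 y) (WithLp.toLp 2 x) := by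
  simp [herm, PiLp.inner_apply, mul_comm]

/-- The sum `f + e` of the components of a pair, as a Euclidean vector. -/
def sumMap (ι : Type*) : ((ι → ℂ) × (ι → ℂ)) →ₗ[ℂ] EuclideanSpace ℂ ι :=
  (WithLp.linearEquiv 2 ℂ (ι → ℂ)).symm.toLinearMap ∘ₗ
    (LinearMap.fst ℂ (ι → ℂ) (ι → ℂ) + LinearMap.snd ℂ (ι → ℂ) (ι → ℂ))

/-- The diagonal embedding `x ↦ (x, x)`. -/
def diagMap (ι : Type*) : EuclideanSpace ℂ ι →ₗ[ℂ] ((ι → ℂ) × (ι → ℂ)) :=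
  (LinearMap.id.prod LinearMap.id) ∘ₗ (WithLp.linearEquiv 2 ℂ (ι → ℂ)).toLinearMap

theorem sumMap_apply {ι : Type*} (p : (ι → ℂ) × (ι → ℂ)) :
    sumMap ι p = WithLp.toLp 2 p.1 + WithLp.toLp 2 p.2 := rfl

theorem sumMap_diagMap {ι : Type*} (x : EuclideanSpace ℂ ι) :
    sumMap ι (diagMap ι x) = x + x := rfl

theorem re_herm_add_diagMap {ι : Type*} [Fintype ι] (p : (ι → ℂ) × (ι → ℂ))
    (x : EuclideanSpace ℂ ι) :
    RCLike.re (herm (p + diagMap ι x).2 (p + diagMap ι x).1) =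
      RCLike.re (herm p.2 p.1) + RCLike.re (inner ℂ (sumMap ι p) x) + ‖x‖ ^ 2 := by
  have h1 : WithLp.toLp 2 (p + diagMap ι x).1 = WithLp.toLp 2 p.1 + x := rfl
  have h2 : WithLp.toLp 2 (p + diagMap ι x).2 = WithLp.toLp 2 p.2 + x := rfl
  rw [herm_eq_inner, herm_eq_inner, h1, h2, sumMap_apply]
  simp only [inner_add_left, inner_add_right, map_add]
  rw [inner_re_symm (𝕜 := ℂ) x (WithLp.toLp 2 p.2), inner_self_eq_norm_sq]
  ring

theorem eq_zero_of_sumMap_eq_zero {ι : Type*} [Fintype ι] {p : (ι → ℂ) × (ι → ℂ)}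
    (hp : 0 ≤ RCLike.re (herm p.2 p.1)) (h : sumMap ι p = 0) : p = 0 := by
  rw [sumMap_apply] at h
  have h2 : WithLp.toLp 2 p.2 = -WithLp.toLp 2 p.1 := eq_neg_of_add_eq_zero_right h
  rw [herm_eq_inner, h2, inner_neg_right, map_neg, inner_self_eq_norm_sq] at hp
  have h3 : WithLp.toLp 2 p.1 = 0 :=
    norm_eq_zero.mp (by nlinarith [norm_nonneg (WithLp.toLp 2 p.1)])
  rw [h3, neg_zero] at h2
  exact Prod.ext ((WithLp.toLp_eq_zero 2).mp h3) ((WithLp.toLp_eq_zero 2).mp h2)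

/-- every monotone subspace of ℂ^n × ℂ^n extends to a maximal monotone one. -/
theorem monotone_extends_to_maximal {n : ℕ}
    (M : Submodule ℂ ((Fin n → ℂ) × (Fin n → ℂ)))
    (hM : ∀ p ∈ M, 0 ≤ RCLike.re (herm p.2 p.1)) :
    ∃ M' : Submodule ℂ ((Fin n → ℂ) × (Fin n → ℂ)),
      M ≤ M' ∧ Module.finrank ℂ M' = n ∧
      ∀ p ∈ M', 0 ≤ RCLike.re (herm p.2 p.1) := by
  set L : Submodule ℂ (EuclideanSpace ℂ (Fin n)) := M.map (sumMap (Fin n))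
  set M' := M ⊔ Lᗮ.map (diagMap (Fin n))
  have hM' : ∀ p ∈ M', 0 ≤ RCLike.re (herm p.2 p.1) := by
    intro p hp
    obtain ⟨q, hq, _, ⟨x, hx, rfl⟩, rfl⟩ := Submodule.mem_sup.mp hp
    have h0 : inner ℂ (sumMap (Fin n) q) x = 0 :=
      (Submodule.mem_orthogonal L x).mp hx _ (Submodule.mem_map_of_mem hq)
    rw [re_herm_add_diagMap, h0, map_zero, add_zero]
    exact add_nonneg (hM q hq) (sq_nonneg _)
  refine ⟨M', le_sup_left, ?_, hM'⟩
  have hinj : Function.Injective ((sumMap (Fin n)).domRestrict M') := by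
    rw [injective_iff_map_eq_zero]
    exact fun p h => Subtype.ext (eq_zero_of_sumMap_eq_zero (hM' p p.2) h)
  have hsurj : Function.Surjective ((sumMap (Fin n)).domRestrict M') := by
    intro y
    obtain ⟨_, ⟨q, hq, rfl⟩, x, hx, rfl⟩ := L.exists_add_mem_mem_orthogonal y
    refine ⟨⟨q + diagMap (Fin n) ((2⁻¹ : ℂ) • x), Submodule.add_mem_sup hq
      (Submodule.mem_map_of_mem (Submodule.smul_mem _ _ hx))⟩, ?_⟩
    rw [LinearMap.domRestrict_apply, map_add, sumMap_diagMap, ← add_smul]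
    norm_num
  rw [(LinearEquiv.ofBijective _ ⟨hinj, hsurj⟩).finrank_eq, finrank_euclideanSpace_fin]
end

section
/- Every resistive subspace R of ℂ^n × ℂ^n (i.e., R ⊆ R* and ⟨e,f⟩ ≤ 0 on R) extends to a maximal resistive subspace R' ⊇ R with dim R' = n. -/
open scoped BigOperators
open Matrix

theorem mem_orthogonal_map_toLp {n : ℕ} (D : Submodule ℂ (Fin n → ℂ))
    (z : EuclideanSpace ℂ (Fin n)) :
    z ∈ (D.map (WithLp.linearEquiv 2 ℂ (Fin n → ℂ)).symm.toLinearMap)ᗮ ↔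
      ∀ x ∈ D, herm z.ofLp x = 0 := by
  simp only [Submodule.mem_orthogonal, Submodule.mem_map, forall_exists_index, and_imp,
    forall_apply_eq_imp_iff₂]
  refine forall₂_congr fun x _ => ?_
  simp [herm, PiLp.inner_apply, mul_comm]

/-- A subspace has an orthogonal complement for `herm`, of complementary dimension. -/
theorem exists_herm_orthogonal {n : ℕ} (D : Submodule ℂ (Fin n → ℂ)) :
    ∃ E : Submodule ℂ (Fin n → ℂ), (∀ z, z ∈ E ↔ ∀ x ∈ D, herm z x = 0) ∧
      Module.finrank ℂ D + Module.finrank ℂ E = n := by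
  set φ := WithLp.linearEquiv 2 ℂ (Fin n → ℂ)
  refine ⟨((D.map φ.symm.toLinearMap)ᗮ).map φ.toLinearMap, fun z => ?_, ?_⟩
  · rw [Submodule.mem_map_equiv, mem_orthogonal_map_toLp]
    rfl
  · have h := Submodule.finrank_add_finrank_orthogonal (D.map φ.symm.toLinearMap)
    rw [LinearEquiv.finrank_map_eq, finrank_euclideanSpace_fin] at h
    rw [LinearEquiv.finrank_map_eq, h]

theorem herm_add_left {ι : Type*} [Fintype ι] (x y z : ι → ℂ) :
    herm (x + y) z = herm x z + herm y z := by
  simp [herm, mul_add, Finset.sum_add_distrib]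

theorem herm_add_right {ι : Type*} [Fintype ι] (x y z : ι → ℂ) :
    herm x (y + z) = herm x y + herm x z := by
  simp [herm, add_mul, Finset.sum_add_distrib]

theorem herm_conj_symm {ι : Type*} [Fintype ι] (x y : ι → ℂ) :
    (starRingEnd ℂ) (herm x y) = herm y x := by
  simp [herm, mul_comm]

theorem herm_eq_zero_symm {ι : Type*} [Fintype ι] {x y : ι → ℂ} (h : herm x y = 0) :
    herm y x = 0 := by
  rw [← herm_conj_symm, h, map_zero]

/-- every resistive subspace of ℂ^n × ℂ^n extends to a maximal resistive one. -/
theorem resistive_extends_to_maximal {n : ℕ}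
    (R : Submodule ℂ ((Fin n → ℂ) × (Fin n → ℂ)))
    (h1 : R ≤ adjRel R)
    (h2 : ∀ p ∈ R, RCLike.im (herm p.1 p.2) = 0 ∧ RCLike.re (herm p.1 p.2) ≤ 0) :
    ∃ R' : Submodule ℂ ((Fin n → ℂ) × (Fin n → ℂ)),
      R ≤ R' ∧ R' ≤ adjRel R' ∧
      (∀ p ∈ R', RCLike.im (herm p.1 p.2) = 0 ∧ RCLike.re (herm p.1 p.2) ≤ 0) ∧
      Module.finrank ℂ R' = n := by
  obtain ⟨E, hE, hdim⟩ := exists_herm_orthogonal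
    (R.map (LinearMap.fst ℂ (Fin n → ℂ) (Fin n → ℂ)))
  have hEl : ∀ z ∈ E, ∀ p ∈ R, herm z p.1 = 0 := fun z hz p hp =>
    (hE z).1 hz p.1 ⟨p, hp, rfl⟩
  have hEr : ∀ z ∈ E, ∀ p ∈ R, herm p.1 z = 0 := fun z hz p hp =>
    herm_eq_zero_symm (hEl z hz p hp)
  have hmem : ∀ p ∈ R ⊔ E.map (LinearMap.inr ℂ (Fin n → ℂ) (Fin n → ℂ)),
      ∃ q ∈ R, ∃ z ∈ E, p.1 = q.1 ∧ p.2 = q.2 + z := by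
    intro p hp
    obtain ⟨q, hq, _, ⟨z, hz, rfl⟩, rfl⟩ := Submodule.mem_sup.1 hp
    exact ⟨q, hq, z, hz, by simp, by simp⟩
  refine ⟨R ⊔ E.map (LinearMap.inr ℂ (Fin n → ℂ) (Fin n → ℂ)), le_sup_left, ?_, ?_, ?_⟩
  · intro p hp q hq
    obtain ⟨p', hp', z, hz, h₁, h₂⟩ := hmem p hp
    obtain ⟨q', hq', w, hw, h₃, h₄⟩ := hmem q hq
    rw [h₁, h₂, h₃, h₄, herm_add_left, herm_add_right, hEl z hz q' hq', hEr w hw p' hp',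
      h1 hp' q' hq']
  · intro p hp
    obtain ⟨q, hq, z, hz, h₁, h₂⟩ := hmem p hp
    rw [h₁, h₂, herm_add_right, hEr z hz q hq, add_zero]
    exact h2 q hq
  · set R' := R ⊔ E.map (LinearMap.inr ℂ (Fin n → ℂ) (Fin n → ℂ)) with hR'
    have hrange : R'.map (LinearMap.fst ℂ (Fin n → ℂ) (Fin n → ℂ)) =
        R.map (LinearMap.fst ℂ (Fin n → ℂ) (Fin n → ℂ)) := by
      rw [hR', Submodule.map_sup, ← Submodule.map_comp, LinearMap.fst_comp_inr,
        Submodule.map_zero, sup_bot_eq]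
    have hker : R' ⊓ LinearMap.ker (LinearMap.fst ℂ (Fin n → ℂ) (Fin n → ℂ)) =
        E.map (LinearMap.inr ℂ (Fin n → ℂ) (Fin n → ℂ)) := by
      apply le_antisymm
      · rintro ⟨x, y⟩ ⟨hp, hx⟩
        obtain ⟨q, hq, z, hz, h₁, h₂⟩ := hmem _ hp
        obtain rfl : x = 0 := hx
        refine ⟨y, (hE y).2 ?_, rfl⟩
        rintro _ ⟨r, hr, rfl⟩
        change y = q.2 + z at h₂
        change (0 : Fin n → ℂ) = q.1 at h₁
        rw [LinearMap.fst_apply, h₂, herm_add_left, hEl z hz r hr, h1 hq r hr, ← h₁]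
        simp [herm]
      · refine le_inf le_sup_right ?_
        rintro _ ⟨z, _, rfl⟩
        simp
    have h := LinearMap.finrank_range_add_finrank_ker
      ((LinearMap.fst ℂ (Fin n → ℂ) (Fin n → ℂ)).domRestrict R')
    have hk := Submodule.finrank_map_subtype_eq R' (LinearMap.ker
      ((LinearMap.fst ℂ (Fin n → ℂ) (Fin n → ℂ)).domRestrict R'))
    rw [LinearMap.ker_domRestrict, Submodule.map_comap_subtype, hker,
      ← (Submodule.equivMapOfInjective (LinearMap.inr ℂ (Fin n → ℂ) (Fin n → ℂ))
        LinearMap.inr_injective E).finrank_eq] at hk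
    rw [LinearMap.range_domRestrict, hrange] at h
    rw [LinearMap.ker_domRestrict] at h
    omega
end

section
/- Let E, Q ∈ K^{n×n} with E*Q = Q*E and ker E ∩ ker Q = {0}. Then L := {(Ez, Qz) : z ∈ K^n} is a Lagrange structure in K^n × K^n, i.e., L = L*. -/
open scoped BigOperators
open Matrix

/-- Membership in the adjoint of an image representation, as a matrix equation. -/
theorem mem_adjRel_range_prod_iff {𝕜 : Type*} [RCLike 𝕜] {n : ℕ}
    (E Q : Matrix (Fin n) (Fin n) 𝕜) (p : (Fin n → 𝕜) × (Fin n → 𝕜)) :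
    p ∈ adjRel (LinearMap.range (E.mulVecLin.prod Q.mulVecLin)) ↔
      Eᴴ *ᵥ p.2 = Qᴴ *ᵥ p.1 := by
  have herm_mulVec (A : Matrix (Fin n) (Fin n) 𝕜) (x z : Fin n → 𝕜) :
      herm x (A *ᵥ z) = star z ⬝ᵥ (Aᴴ *ᵥ x) := by
    rw [dotProduct_mulVec, ← star_mulVec]
    rfl
  have mem_iff : p ∈ adjRel (LinearMap.range (E.mulVecLin.prod Q.mulVecLin)) ↔
      ∀ z, herm p.2 (E *ᵥ z) = herm p.1 (Q *ᵥ z) :=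
    ⟨fun h z => h _ ⟨z, rfl⟩, by rintro h _ ⟨z, rfl⟩; exact h z⟩
  simp only [mem_iff, herm_mulVec]
  refine ⟨fun h => dotProduct_eq _ _ fun w => ?_, fun h z => by rw [h]⟩
  simpa [dotProduct_comm] using h (star w)

/-- If the kernels of `E` and `Q` meet trivially, then `(a, b) ↦ Eᴴ b - Qᴴ a` is onto. -/
theorem surjective_conjTranspose_sub {𝕜 : Type*} [RCLike 𝕜] {n : ℕ}
    (E Q : Matrix (Fin n) (Fin n) 𝕜)
    (hker : ∀ z : Fin n → 𝕜, E *ᵥ z = 0 → Q *ᵥ z = 0 → z = 0) :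
    Function.Surjective (Eᴴ.mulVecLin.comp (LinearMap.snd 𝕜 (Fin n → 𝕜) (Fin n → 𝕜)) -
      Qᴴ.mulVecLin.comp (LinearMap.fst 𝕜 (Fin n → 𝕜) (Fin n → 𝕜))) := by
  have hinj : Function.Injective (Eᴴ * E + Qᴴ * Q).mulVecLin := by
    rw [← LinearMap.ker_eq_bot, LinearMap.ker_eq_bot']
    intro z hz
    have hsum : star (E *ᵥ z) ⬝ᵥ (E *ᵥ z) + star (Q *ᵥ z) ⬝ᵥ (Q *ᵥ z) = 0 := by
      simpa [add_mulVec, dotProduct_add, ← mulVec_mulVec, dotProduct_mulVec, star_mulVec]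
        using congrArg (star z ⬝ᵥ ·) hz
    open scoped ComplexOrder in
    obtain ⟨hE, hQ⟩ := (add_eq_zero_iff_of_nonneg (dotProduct_star_self_nonneg _)
      (dotProduct_star_self_nonneg _)).1 hsum
    open scoped ComplexOrder in
    exact hker z (dotProduct_star_self_eq_zero.1 hE) (dotProduct_star_self_eq_zero.1 hQ)
  intro y
  obtain ⟨z, rfl⟩ := LinearMap.injective_iff_surjective.1 hinj y
  exact ⟨(-(Q *ᵥ z), E *ᵥ z), by simp [mulVec_neg]⟩

/-- if E*Q = Q*E and ker E ∩ ker Q = {0}, then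
L = {(Ez, Qz) : z} is a Lagrange structure. -/
theorem range_EQ_lagrange {𝕜 : Type*} [RCLike 𝕜] {n : ℕ}
    (E Q : Matrix (Fin n) (Fin n) 𝕜)
    (hEQ : Eᴴ * Q = Qᴴ * E)
    (hker : ∀ z : Fin n → 𝕜, E.mulVec z = 0 → Q.mulVec z = 0 → z = 0) :
    LinearMap.range (E.mulVecLin.prod Q.mulVecLin) =
      adjRel (LinearMap.range (E.mulVecLin.prod Q.mulVecLin)) := by
  set S := E.mulVecLin.prod Q.mulVecLin with hS
  set T := Eᴴ.mulVecLin.comp (LinearMap.snd 𝕜 (Fin n → 𝕜) (Fin n → 𝕜)) -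
    Qᴴ.mulVecLin.comp (LinearMap.fst 𝕜 (Fin n → 𝕜) (Fin n → 𝕜)) with hT
  have hadj : adjRel (LinearMap.range S) = LinearMap.ker T := by
    ext p
    rw [hS, mem_adjRel_range_prod_iff]
    simp [hT, sub_eq_zero]
  have hle : LinearMap.range S ≤ LinearMap.ker T := by
    rintro _ ⟨z, rfl⟩
    simp [hS, hT, hEQ]
  have hinj : Function.Injective S := by
    rw [← LinearMap.ker_eq_bot, LinearMap.ker_eq_bot']
    intro z hz
    exact hker z (congrArg Prod.fst hz) (congrArg Prod.snd hz)
  have hrange : Module.finrank 𝕜 (LinearMap.range S) = n := by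
    simpa using LinearMap.finrank_range_of_inj hinj
  have hsurj : LinearMap.range T = ⊤ :=
    LinearMap.range_eq_top.2 (surjective_conjTranspose_sub E Q hker)
  have hrank := T.finrank_range_add_finrank_ker
  rw [hsurj, finrank_top] at hrank
  simp only [Module.finrank_prod, Module.finrank_fin_fun] at hrank
  rw [hadj]
  exact Submodule.eq_of_le_of_finrank_eq hle (by omega)
end
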